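/- Suppose [·,·] is a Lie bracket on ℝ^7 and Λ : ℝ^7 → 𝔤𝔩(7,ℝ) is a linear map with Λ(x)y − Λ(y)x = [x,y] and Λ(x) ∈ 𝔥^I for all x,y ∈ ℝ^7, and suppose the infinitesimal holonomy 𝔥 equals 𝔞 ⋉ 𝔪(1,0,k), one of the listed type III algebras. Write Λ(e_i) = h(A_i, v_i, u_i, y_i) with A_i = (a_{i1}, a_{i2}; a_{i3}, a_{i4}). If a_{i3} = 0 for all i = 1,…,7 (all A_i upper triangular) or a_{i2} = 0 for all i = 1,…,7 (all A_i lower triangular), then 𝔞 = 0, i.e. 𝔥 = 𝔪(1,0,k). -/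

import Mathlib

open Matrix

noncomputable section

abbrev V7 : Type := Fin 7 → ℝ
abbrev M7 : Type := Matrix (Fin 7) (Fin 7) ℝ
abbrev M2 : Type := Matrix (Fin 2) (Fin 2) ℝ

/-- The standard basis of `ℝ^7` (0-indexed: `e 0` is `e_1` of the paper). -/
def e (i : Fin 7) : V7 := Pi.single i 1

/-- The matrix `h(A,v,u,y)`. -/
def hmat (A : M2) (v : ℝ) (u y : Fin 2 → ℝ) : M7 :=
  !![A 0 0 + A 1 1, -u 1, u 0, Real.sqrt 2 * v, 0, -y 0, -y 1;
     0, A 0 0, A 0 1, Real.sqrt 2 * u 0, y 0, 0, v;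
     0, A 1 0, A 1 1, Real.sqrt 2 * u 1, y 1, -v, 0;
     0, 0, 0, 0, Real.sqrt 2 * v, Real.sqrt 2 * u 0, Real.sqrt 2 * u 1;
     0, 0, 0, 0, -(A 0 0 + A 1 1), 0, 0;
     0, 0, 0, 0, u 1, -A 0 0, -A 1 0;
     0, 0, 0, 0, -u 0, -A 0 1, -A 1 1]

/-- `𝔥^I = {h(A,v,u,y)}`. -/
def hI : Set M7 := {X | ∃ A v u y, X = hmat A v u y}

/-- The matrix `h(A,v,y) := h(A,v,0,y)`. -/
def h3 (A : M2) (v : ℝ) (y : Fin 2 → ℝ) : M7 := hmat A v 0 y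

/-- `𝔥^III = {h(A,v,y)}`. -/
def hIII : Set M7 := {X | ∃ A v y, X = h3 A v y}

/-- `𝔪(1,0,1) = {h(0,v,(y_1,0))}`. -/
def m101 : Set M7 := {X | ∃ v y1, X = h3 0 v ![y1, 0]}

/-- `𝔪(1,0,2) = {h(0,v,(y_1,y_2))}`. -/
def m102 : Set M7 := {X | ∃ v y, X = h3 0 v y}

/-- The projection `pro_A` (reading off the relevant entries; on `𝔥^III` and `𝔥^I`
it gives the `𝔤𝔩(2,ℝ)`-component `A`). -/
def proA (X : M7) : M2 := !![X 1 1, X 1 2; X 2 1, X 2 2]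

/-- The projection `pro_v` (on `𝔥^III` and `𝔥^I` it gives the component `v`). -/
def proV (X : M7) : ℝ := X 1 6

/-- The curvature `R(x,y) = Λ(x)Λ(y) − Λ(y)Λ(x) − Λ([x,y])`. -/
def curv (L : V7 →ₗ[ℝ] M7) (bk : V7 → V7 → V7) (x y : V7) : M7 :=
  L x * L y - L y * L x - L (bk x y)

/-- The infinitesimal holonomy: the smallest linear subspace of `𝔤𝔩(7,ℝ)` containing
all `R(x,y)` and stable under bracketing with all `Λ(z)`. -/
def infHol (L : V7 →ₗ[ℝ] M7) (bk : V7 → V7 → V7) : Submodule ℝ M7 :=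
  sInf {H : Submodule ℝ M7 | (∀ x y, curv L bk x y ∈ H) ∧
    ∀ z : V7, ∀ X ∈ H, L z * X - X * L z ∈ H}

/-- `𝔰𝔩(2,ℝ)` as a set of 2×2 matrices. -/
def sl2 : Set M2 := {A | A 0 0 + A 1 1 = 0}

/-- `𝔤𝔩(2,ℝ)` as a set of 2×2 matrices. -/
def gl2 : Set M2 := Set.univ

/-- `𝔠𝔬(2) = {(a,−b;b,a)}`. -/
def co2 : Set M2 := {A | ∃ a b : ℝ, A = !![a, -b; b, a]}

/-- `𝔡`, the diagonal 2×2 matrices. -/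
def dd : Set M2 := {A | A 0 1 = 0 ∧ A 1 0 = 0}

/-- `ℝ·diag(1,0)`. -/
def rdiag10 : Set M2 := {A | ∃ t : ℝ, A = !![t, 0; 0, 0]}

/-- `𝔞 ⋉ 𝔪(1,0,k)`. -/
def semidir (a : Set M2) : ℕ → Set M7
  | 1 => {X | ∃ A ∈ a, ∃ v y1, X = h3 A v ![y1, 0]}
  | _ => {X | ∃ A ∈ a, ∃ v y, X = h3 A v y}

/-- The pairs `(𝔞, k)` occurring in the list of type III holonomy algebras. -/
def ListedPair (a : Set M2) (k : ℕ) : Prop :=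
  ((a = sl2 ∨ a = gl2 ∨ a = co2 ∨ a = dd) ∧ k = 2) ∨
  ((a = ({0} : Set M2) ∨ a = rdiag10) ∧ (k = 1 ∨ k = 2))

/-- The listed type III holonomy algebras `𝔞 ⋉ 𝔪(1,0,k)`. -/
def ListedTypeIII (S : Set M7) : Prop := ∃ a k, ListedPair a k ∧ S = semidir a k

/-! ### The infinitesimal holonomy -/

theorem curv_mem_infHol (L : V7 →ₗ[ℝ] M7) (bk : V7 → V7 → V7) (x y : V7) :
    curv L bk x y ∈ infHol L bk :=
  Submodule.mem_sInf.2 fun _ hH => hH.1 x y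

theorem lie_mem_infHol (L : V7 →ₗ[ℝ] M7) (bk : V7 → V7 → V7) (z : V7) {X : M7}
    (hX : X ∈ infHol L bk) : L z * X - X * L z ∈ infHol L bk :=
  Submodule.mem_sInf.2 fun H hH => hH.2 z X (Submodule.mem_sInf.1 hX H hH)

theorem infHol_le {L : V7 →ₗ[ℝ] M7} {bk : V7 → V7 → V7} {H : Submodule ℝ M7}
    (h₁ : ∀ x y, curv L bk x y ∈ H) (h₂ : ∀ z, ∀ X ∈ H, L z * X - X * L z ∈ H) :
    infHol L bk ≤ H :=
  sInf_le ⟨h₁, h₂⟩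

/-- If all `Λ(x)` are block triangular for the same block structure, so is the holonomy. -/
theorem blockTriangular_of_mem_infHol {L : V7 →ₗ[ℝ] M7} {bk : V7 → V7 → V7} (b : Fin 7 → ℕ)
    (hL : ∀ x, (L x).BlockTriangular b) {X : M7} (hX : X ∈ infHol L bk) :
    X.BlockTriangular b := by
  let K : Submodule ℝ M7 :=
    { carrier := {X | X.BlockTriangular b}
      add_mem' := fun h₁ h₂ => h₁.add h₂
      zero_mem' := blockTriangular_zero
      smul_mem' := fun c X h i j hij => by simp [h hij] }
  have hK : infHol L bk ≤ K := infHol_le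
    (fun x y => (((hL x).mul (hL y)).sub ((hL y).mul (hL x))).sub (hL _))
    (fun z X h => ((hL z).mul h).sub (BlockTriangular.mul h (hL z)))
  exact hK hX

/-- The algebraic (first) Bianchi identity. -/
theorem curv_bianchi {L : V7 →ₗ[ℝ] M7} {bk : V7 → V7 → V7}
    (hbk : ∀ x y : V7, (L x).mulVec y - (L y).mulVec x = bk x y)
    (hjac : ∀ x y z : V7, bk (bk x y) z + bk (bk y z) x + bk (bk z x) y = 0) (x y z : V7) :
    (curv L bk x y).mulVec z + (curv L bk y z).mulVec x + (curv L bk z x).mulVec y = 0 := by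
  have h := hjac x y z
  rw [← hbk (bk x y), ← hbk (bk y z), ← hbk (bk z x)] at h
  have h₁ : (L z).mulVec (bk x y) = (L z * L x).mulVec y - (L z * L y).mulVec x := by
    rw [← hbk, mulVec_sub, mulVec_mulVec, mulVec_mulVec]
  have h₂ : (L x).mulVec (bk y z) = (L x * L y).mulVec z - (L x * L z).mulVec y := by
    rw [← hbk, mulVec_sub, mulVec_mulVec, mulVec_mulVec]
  have h₃ : (L y).mulVec (bk z x) = (L y * L z).mulVec x - (L y * L x).mulVec z := by
    rw [← hbk, mulVec_sub, mulVec_mulVec, mulVec_mulVec]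
  rw [h₁, h₂, h₃] at h
  simp only [curv, sub_mulVec]
  rw [← neg_eq_zero, ← h]
  abel

/-! ### Connections with diagonal `A` and `u₁ = 0` -/

theorem e_apply (i j : Fin 7) : e i j = if j = i then 1 else 0 := by
  simp [e, Pi.single_apply]

theorem linear_expand (φ : V7 →ₗ[ℝ] ℝ) (x : V7) :
    φ x = x 0 * φ (e 0) + x 1 * φ (e 1) + x 2 * φ (e 2) + x 3 * φ (e 3) + x 4 * φ (e 4)
      + x 5 * φ (e 5) + x 6 * φ (e 6) := by
  have h : x = x 0 • e 0 + x 1 • e 1 + x 2 • e 2 + x 3 • e 3 + x 4 • e 4 + x 5 • e 5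
      + x 6 • e 6 := by
    ext i
    fin_cases i <;> simp [e_apply]
  conv_lhs => rw [h]
  simp only [map_add, map_smul, smul_eq_mul]

/-- The Bianchi identity for the weight component `D = dφ + ω ∧ φ` of the curvature. -/
theorem weight_bianchi {bk : V7 → V7 → V7}
    (hjac : ∀ x y z : V7, bk (bk x y) z + bk (bk y z) x + bk (bk z x) y = 0)
    (ω φ : V7 →ₗ[ℝ] ℝ) (D : V7 → V7 → ℝ)
    (hD : ∀ x y, D x y = ω x * φ y - ω y * φ x - φ (bk x y)) (x y z : V7) :
    D (bk x y) z + D (bk y z) x + D (bk z x) y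
      = ω z * D x y + ω x * D y z + ω y * D z x
        + ω (bk x y) * φ z + ω (bk y z) * φ x + ω (bk z x) * φ y := by
  have h := congrArg φ (hjac x y z)
  simp only [map_add, map_zero] at h
  simp only [hD]
  linear_combination -h

/-- The structure equations of a torsion-free connection with values
`h(diag(α,δ), v, (0,μ), (p,q))` whose curvature has components
`h(diag(F,G), W, 0, (S,T))`. -/
structure DiagConnection (bk : V7 → V7 → V7) (α δ μ v p q : V7 →ₗ[ℝ] ℝ)
    (F G W S T : V7 → V7 → ℝ) (r : ℝ) : Prop where
  jac : ∀ x y z, bk (bk x y) z + bk (bk y z) x + bk (bk z x) y = 0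
  bk_zero : ∀ x y, bk x y 0 = (α x + δ x) * y 0 - μ x * y 1 + r * v x * y 3 - p x * y 5 - q x * y 6
    - ((α y + δ y) * x 0 - μ y * x 1 + r * v y * x 3 - p y * x 5 - q y * x 6)
  bk_one : ∀ x y, bk x y 1 = α x * y 1 + p x * y 4 + v x * y 6
    - (α y * x 1 + p y * x 4 + v y * x 6)
  bk_two : ∀ x y, bk x y 2 = δ x * y 2 + r * μ x * y 3 + q x * y 4 - v x * y 5
    - (δ y * x 2 + r * μ y * x 3 + q y * x 4 - v y * x 5)
  bk_three : ∀ x y, bk x y 3 = r * v x * y 4 + r * μ x * y 6 - (r * v y * x 4 + r * μ y * x 6)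
  bk_four : ∀ x y, bk x y 4 = -(α x + δ x) * y 4 + (α y + δ y) * x 4
  bk_five : ∀ x y, bk x y 5 = μ x * y 4 - α x * y 5 - (μ y * x 4 - α y * x 5)
  bk_six : ∀ x y, bk x y 6 = -δ x * y 6 + δ y * x 6
  F_eq : ∀ x y, F x y = -α (bk x y)
  G_eq : ∀ x y, G x y = -δ (bk x y)
  W_eq : ∀ x y, W x y = (α x + δ x) * v y - (α y + δ y) * v x - v (bk x y)
  S_eq : ∀ x y, S x y = (2 * α x + δ x) * p y - (2 * α y + δ y) * p x - p (bk x y)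
  F_skew : ∀ x y, F x y = -F y x
  G_skew : ∀ x y, G x y = -G y x
  W_skew : ∀ x y, W x y = -W y x
  S_skew : ∀ x y, S x y = -S y x
  T_skew : ∀ x y, T x y = -T y x
  bianchi_zero : ∀ x y z,
    ((F x y + G x y) * z 0 + r * W x y * z 3 - S x y * z 5 - T x y * z 6)
      + ((F y z + G y z) * x 0 + r * W y z * x 3 - S y z * x 5 - T y z * x 6)
      + ((F z x + G z x) * y 0 + r * W z x * y 3 - S z x * y 5 - T z x * y 6) = 0
  bianchi_one : ∀ x y z,
    (F x y * z 1 + S x y * z 4 + W x y * z 6) + (F y z * x 1 + S y z * x 4 + W y z * x 6)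
      + (F z x * y 1 + S z x * y 4 + W z x * y 6) = 0
  bianchi_two : ∀ x y z,
    (G x y * z 2 + T x y * z 4 - W x y * z 5) + (G y z * x 2 + T y z * x 4 - W y z * x 5)
      + (G z x * y 2 + T z x * y 4 - W z x * y 5) = 0
  bianchi_three : ∀ x y z, W x y * z 4 + W y z * x 4 + W z x * y 4 = 0
  bianchi_four : ∀ x y z,
    (F x y + G x y) * z 4 + (F y z + G y z) * x 4 + (F z x + G z x) * y 4 = 0
  bianchi_five : ∀ x y z, F x y * z 5 + F y z * x 5 + F z x * y 5 = 0
  bianchi_six : ∀ x y z, G x y * z 6 + G y z * x 6 + G z x * y 6 = 0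

namespace DiagConnection

variable {bk : V7 → V7 → V7} {α δ μ v p q : V7 →ₗ[ℝ] ℝ} {F G W S T : V7 → V7 → ℝ} {r : ℝ}

theorem F_five_six (h : DiagConnection bk α δ μ v p q F G W S T r) : F (e 5) (e 6) = 0 := by
  have h₁ := h.bianchi_one (e 1) (e 5) (e 6)
  have h₂ := h.bianchi_three (e 1) (e 5) (e 4)
  simp [e_apply] at h₁ h₂
  linarith

theorem G_five_six (h : DiagConnection bk α δ μ v p q F G W S T r) : G (e 5) (e 6) = 0 := by
  have h₁ := h.bianchi_four (e 5) (e 6) (e 4)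
  simp [e_apply, h.F_five_six] at h₁
  exact h₁

theorem F_form (h : DiagConnection bk α δ μ v p q F G W S T r) (x y : V7) :
    F x y = F (e 4) (e 5) * (x 4 * y 5 - x 5 * y 4) := by
  have key : ∀ x, F x (e 5) = (F (e 4) (e 5) + G (e 4) (e 5)) * x 4 := fun x => by
    have h₁ := h.bianchi_four x (e 5) (e 4)
    have h₂ := h.bianchi_six x (e 5) (e 6)
    have h₃ := h.F_skew (e 5) (e 4)
    have h₄ := h.G_skew (e 5) (e 4)
    simp [e_apply, h.G_five_six] at h₁ h₂
    rw [h₃, h₄] at h₁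
    linarith
  have h₀ : G (e 4) (e 5) = 0 := by
    have h₁ := key (e 4)
    simp [e_apply] at h₁
    exact h₁
  have h₁ := h.bianchi_five x y (e 5)
  rw [h.F_skew (e 5) x, key x, key y, h₀] at h₁
  simp [e_apply] at h₁
  linarith

theorem G_form (h : DiagConnection bk α δ μ v p q F G W S T r) (x y : V7) :
    G x y = G (e 4) (e 6) * (x 4 * y 6 - x 6 * y 4) := by
  have key : ∀ x, G x (e 6) = G (e 4) (e 6) * x 4 := fun x => by
    have h₁ := h.bianchi_four x (e 6) (e 4)
    have h₃ := h.G_skew (e 6) (e 4)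
    rw [h.F_form x (e 6), h.F_form (e 6) (e 4), h₃] at h₁
    simp [e_apply] at h₁
    linarith
  have h₁ := h.bianchi_six x y (e 6)
  rw [h.G_skew (e 6) x, key x, key y] at h₁
  simp [e_apply] at h₁
  linarith

theorem F_closed (h : DiagConnection bk α δ μ v p q F G W S T r) (x y z : V7) :
    F (bk x y) z + F (bk y z) x + F (bk z x) y = 0 := by
  have h₁ := congrArg α (h.jac x y z)
  simp only [map_add, map_zero] at h₁
  simp only [h.F_eq]
  linarith

theorem G_closed (h : DiagConnection bk α δ μ v p q F G W S T r) (x y z : V7) :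
    G (bk x y) z + G (bk y z) x + G (bk z x) y = 0 := by
  have h₁ := congrArg δ (h.jac x y z)
  simp only [map_add, map_zero] at h₁
  simp only [h.G_eq]
  linarith

theorem two_α_add_δ (h : DiagConnection bk α δ μ v p q F G W S T r) (hc : F (e 4) (e 5) ≠ 0)
    (x : V7) : 2 * α x + δ x
      = (2 * α (e 4) + δ (e 4)) * x 4 + (2 * α (e 5) + δ (e 5)) * x 5 := by
  have h₁ := h.F_closed x (e 4) (e 5)
  simp only [h.F_form (bk _ _)] at h₁
  simp [e_apply, h.bk_four, h.bk_five] at h₁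
  apply mul_left_cancel₀ hc
  linear_combination -h₁

theorem α_add_two_δ (h : DiagConnection bk α δ μ v p q F G W S T r) (hc : G (e 4) (e 6) ≠ 0)
    (x : V7) : α x + 2 * δ x
      = (α (e 4) + 2 * δ (e 4)) * x 4 + (α (e 6) + 2 * δ (e 6)) * x 6 := by
  have h₁ := h.G_closed x (e 4) (e 6)
  simp only [h.G_form (bk _ _)] at h₁
  simp [e_apply, h.bk_four, h.bk_six] at h₁
  apply mul_left_cancel₀ hc
  linear_combination -h₁

/-- The derivative of `2α + δ`, once it is known to lie in the span of `e⁵` and `e⁶`. -/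
theorem two_F_add_G (h : DiagConnection bk α δ μ v p q F G W S T r) (hc : F (e 4) (e 5) ≠ 0)
    (x y : V7) : 2 * F x y + G x y
      = -((2 * α (e 4) + δ (e 4)) * bk x y 4 + (2 * α (e 5) + δ (e 5)) * bk x y 5) := by
  rw [← h.two_α_add_δ hc, h.F_eq, h.G_eq]
  ring

theorem F_or_G_eq_zero (h : DiagConnection bk α δ μ v p q F G W S T r) (hμ : ∀ x, μ x = 0) :
    F (e 4) (e 5) = 0 ∨ G (e 4) (e 6) = 0 := by
  by_contra! hne
  obtain ⟨hc, hc'⟩ := hne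
  have ξ6 := h.two_α_add_δ hc (e 6)
  have η5 := h.α_add_two_δ hc' (e 5)
  have h46 := h.two_F_add_G hc (e 4) (e 6)
  have h56 := h.two_F_add_G hc (e 5) (e 6)
  have h45 := h.two_F_add_G hc (e 4) (e 5)
  have k45 := h.α_add_two_δ hc' (bk (e 4) (e 5))
  have F45 := h.F_eq (e 4) (e 5)
  have G45 := h.G_eq (e 4) (e 5)
  rw [h.F_form (e 4) (e 6)] at h46
  rw [h.F_five_six, h.G_five_six] at h56
  rw [h.G_form (e 4) (e 5)] at h45 G45
  simp [e_apply, h.bk_four, h.bk_five, h.bk_six, hμ] at ξ6 η5 h46 h56 h45 k45 G45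
  have hα6 : α (e 6) ≠ 0 := fun h0 => hc' (by
    rw [h46, show δ (e 6) = -2 * α (e 6) by linarith, h0]; ring)
  have hQ : 2 * α (e 5) + δ (e 5) = 0 := by tauto
  apply hc
  have h5 : α (e 5) = 0 ∧ δ (e 5) = 0 := ⟨by linarith, by linarith⟩
  rw [h5.1, h5.2] at k45
  linarith

/-- If `G = 0`, then `α` and `μ` lie in the span of `e⁵` and `e⁶`. -/
theorem α_μ_eq_zero (h : DiagConnection bk α δ μ v p q F G W S T r) (hc : F (e 4) (e 5) ≠ 0)
    (hG : ∀ x y, G x y = 0) : ∀ x : V7, x 4 = 0 → x 5 = 0 → α x = 0 ∧ μ x = 0 := by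
  have key : ∀ x : V7, x 4 = 0 → x 5 = 0 →
      (2 * α (e 5) + δ (e 5)) * α x = 0 ∧
      (2 * α (e 4) + δ (e 4)) * α x + (2 * α (e 5) + δ (e 5)) * μ x = 0 := by
    intro x h4 h5
    have h₀ := h.two_α_add_δ hc x
    have h₁ := h.two_F_add_G hc x (e 5)
    have h₂ := h.two_F_add_G hc x (e 4)
    rw [h.F_form, hG] at h₁ h₂
    simp [e_apply, h.bk_four, h.bk_five, h4, h5] at h₀ h₁ h₂
    constructor
    · rcases h₁ with h₁ | h₁ <;> simp [h₁]
    · linear_combination (2 * α (e 4) + δ (e 4)) * h₀ + h₂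
  have h45 := h.two_F_add_G hc (e 4) (e 5)
  rw [hG] at h45
  simp [e_apply, h.bk_four, h.bk_five] at h45
  by_cases hQ : 2 * α (e 5) + δ (e 5) = 0
  · have hP : 2 * α (e 4) + δ (e 4) ≠ 0 := fun hP => hc (by rw [hP, hQ] at h45; linarith)
    have hα : ∀ x : V7, x 4 = 0 → x 5 = 0 → α x = 0 := fun x h4 h5 => by
      have h₁ := (key x h4 h5).2
      rw [hQ] at h₁
      simpa [hP] using h₁
    have hα5 : α (e 5) ≠ 0 := fun h0 => hc (by
      rw [hQ, show δ (e 5) = -2 * α (e 5) by linarith, h0] at h45; linarith)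
    intro x h4 h5
    refine ⟨hα x h4 h5, ?_⟩
    have h₁ := h.F_eq x (e 4)
    rw [h.F_form, linear_expand α] at h₁
    have h0 : α (e 0) = 0 := hα _ (by simp [e_apply]) (by simp [e_apply])
    have h1 : α (e 1) = 0 := hα _ (by simp [e_apply]) (by simp [e_apply])
    have h2 : α (e 2) = 0 := hα _ (by simp [e_apply]) (by simp [e_apply])
    have h3 : α (e 3) = 0 := hα _ (by simp [e_apply]) (by simp [e_apply])
    have h6 : α (e 6) = 0 := hα _ (by simp [e_apply]) (by simp [e_apply])
    have hδ : δ x = 0 := by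
      have h₂ := h.two_α_add_δ hc x
      rw [hα x h4 h5, h4, h5] at h₂
      linarith
    simp [e_apply, h.bk_four, h.bk_five, h4, h5, h0, h1, h2, h3, h6, hα x h4 h5, hδ, hα5] at h₁
    exact h₁
  · intro x h4 h5
    obtain ⟨h₁, h₂⟩ := key x h4 h5
    have hα : α x = 0 := by simpa [hQ] using h₁
    rw [hα] at h₂
    exact ⟨hα, by simpa [hQ] using h₂⟩

theorem W_form (h : DiagConnection bk α δ μ v p q F G W S T r) (x y : V7) :
    W x y = W x (e 4) * y 4 - W y (e 4) * x 4 := by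
  have h₁ := h.bianchi_three x y (e 4)
  rw [h.W_skew (e 4) x] at h₁
  simp [e_apply] at h₁
  linarith

theorem S_form (h : DiagConnection bk α δ μ v p q F G W S T r) (x y : V7) :
    S x y = S x (e 4) * y 4 - S y (e 4) * x 4 + W x (e 4) * y 6 - W y (e 4) * x 6
      + F (e 4) (e 5) * (x 1 * y 5 - x 5 * y 1) := by
  have h₁ := h.bianchi_one x y (e 4)
  rw [h.W_skew (e 4) x, h.S_skew (e 4) x, h.F_form y (e 4), h.F_form (e 4) x] at h₁
  simp [e_apply] at h₁
  linarith

theorem T_form (h : DiagConnection bk α δ μ v p q F G W S T r) (hG : ∀ x y, G x y = 0)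
    (x y : V7) :
    T x y = T x (e 4) * y 4 - T y (e 4) * x 4 - W x (e 4) * y 5 + W y (e 4) * x 5 := by
  have h₁ := h.bianchi_two x y (e 4)
  rw [h.W_skew (e 4) x, h.T_skew (e 4) x] at h₁
  simp [e_apply, hG] at h₁
  linarith

theorem W_four_form (h : DiagConnection bk α δ μ v p q F G W S T r) (hG : ∀ x y, G x y = 0)
    (x : V7) : W x (e 4) = W (e 5) (e 4) * x 5 + W (e 6) (e 4) * x 6 := by
  have key : ∀ x : V7, 2 * W x (e 4) = 2 * W (e 5) (e 4) * x 5 + 2 * W (e 6) (e 4) * x 6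
      + (S (e 6) (e 4) - T (e 5) (e 4)) * x 4 := fun x => by
    have h₁ := h.bianchi_zero x (e 5) (e 6)
    rw [h.S_form (e 5) (e 6), h.S_form (e 6) x, h.T_form hG x (e 5), h.T_form hG (e 5) (e 6),
      h.W_form x (e 5), h.W_form (e 5) (e 6), h.W_form (e 6) x, h.F_five_six] at h₁
    simp [e_apply, hG] at h₁
    linarith
  have h₁ := key (e 4)
  have h₂ := h.W_skew (e 4) (e 4)
  simp [e_apply] at h₁
  rw [show S (e 6) (e 4) - T (e 5) (e 4) = 0 by linarith] at key
  linarith [key x]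

theorem S_four_form (h : DiagConnection bk α δ μ v p q F G W S T r) (hG : ∀ x y, G x y = 0)
    (x : V7) : S x (e 4) = F (e 4) (e 5) * x 0 - r * W (e 5) (e 4) * x 3 + S (e 5) (e 4) * x 5
      + T (e 5) (e 4) * x 6 := by
  have h₁ := h.bianchi_zero x (e 4) (e 5)
  rw [h.S_skew (e 4) (e 5), h.T_skew (e 4) (e 5), h.W_skew (e 4) (e 5)] at h₁
  simp [e_apply, hG] at h₁
  linarith

theorem F_eq_zero (h : DiagConnection bk α δ μ v p q F G W S T r) (hG : ∀ x y, G x y = 0) :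
    F (e 4) (e 5) = 0 := by
  by_contra hc
  have hW : ∀ x y, W x y = (W (e 5) (e 4) * x 5 + W (e 6) (e 4) * x 6) * y 4
      - (W (e 5) (e 4) * y 5 + W (e 6) (e 4) * y 6) * x 4 := fun x y => by
    rw [h.W_form, h.W_four_form hG x, h.W_four_form hG y]
  have hS : ∀ x y, S x y
      = (F (e 4) (e 5) * x 0 - r * W (e 5) (e 4) * x 3 + S (e 5) (e 4) * x 5
          + T (e 5) (e 4) * x 6) * y 4
        - (F (e 4) (e 5) * y 0 - r * W (e 5) (e 4) * y 3 + S (e 5) (e 4) * y 5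
          + T (e 5) (e 4) * y 6) * x 4
        + (W (e 5) (e 4) * x 5 + W (e 6) (e 4) * x 6) * y 6
        - (W (e 5) (e 4) * y 5 + W (e 6) (e 4) * y 6) * x 6
        + F (e 4) (e 5) * (x 1 * y 5 - x 5 * y 1) := fun x y => by
    rw [h.S_form, h.S_four_form hG x, h.S_four_form hG y, h.W_four_form hG x,
      h.W_four_form hG y]
  have hF := h.F_form
  have h45 := h.two_F_add_G hc (e 4) (e 5)
  have hξ := h.two_α_add_δ hc
  have hz := h.α_μ_eq_zero hc hG
  generalize F (e 4) (e 5) = c at *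
  generalize W (e 5) (e 4) = w₅ at *
  generalize W (e 6) (e 4) = w₆ at *
  generalize S (e 5) (e 4) = s₅ at *
  generalize T (e 5) (e 4) = t₅ at *
  have z0 := hz (e 0) (by simp [e_apply]) (by simp [e_apply])
  have z1 := hz (e 1) (by simp [e_apply]) (by simp [e_apply])
  have z6 := hz (e 6) (by simp [e_apply]) (by simp [e_apply])
  have d0 := hξ (e 0)
  have d1 := hξ (e 1)
  have d6 := hξ (e 6)
  simp [e_apply, z0, z1, z6] at d0 d1 d6
  rw [hG] at h45
  simp [e_apply, h.bk_four, h.bk_five] at h45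
  have bW := weight_bianchi h.jac (α + δ) v W (fun x y => h.W_eq x y)
  have bS := weight_bianchi h.jac (2 • α + δ) p S (fun x y => by simp [h.S_eq])
  have hα : ∀ x y, α (bk x y) = -(c * (x 4 * y 5 - x 5 * y 4)) := fun x y => by
    rw [← hF, h.F_eq, neg_neg]
  have hδ : ∀ x y, δ (bk x y) = 0 := fun x y => by
    rw [← neg_eq_zero, ← h.G_eq, hG]
  have v0 := bW (e 0) (e 4) (e 5)
  have v1 := bW (e 1) (e 4) (e 5)
  have p0 := bS (e 0) (e 4) (e 5)
  have p1 := bS (e 1) (e 4) (e 5)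
  have q0 := bS (e 0) (e 4) (e 6)
  have E1 := h.S_eq (e 0) (e 4)
  have E2 := h.S_eq (e 1) (e 5)
  rw [linear_expand p (bk _ _)] at E1 E2
  simp only [hW, hS, LinearMap.add_apply, LinearMap.smul_apply, hα, hδ] at v0 v1 p0 p1 q0 E1 E2
  simp [e_apply, h.bk_zero, h.bk_one, h.bk_two, h.bk_three, h.bk_four, h.bk_five, h.bk_six,
    z0, z1, z6, d0, d1, d6] at v0 v1 p0 p1 q0 E1 E2
  replace v0 := v0.resolve_left hc
  replace v1 := v1.resolve_left hc
  replace q0 := q0.resolve_left hc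
  have hQ : δ (e 5) = 4 * p (e 0) - 2 * α (e 5) :=
    mul_left_cancel₀ hc (by linear_combination -p0)
  have hP : δ (e 4) = -4 * p (e 1) - 2 * α (e 4) :=
    mul_left_cancel₀ hc (by linear_combination p1)
  simp only [hP, hQ, v0, v1, q0] at E1 E2 h45
  apply hc
  linear_combination (2 / 5) * (E1 + E2 + h45 / 4)

end DiagConnection

/-! ### Reduction to diagonal connections -/

theorem linear_apply_of_basis {L : V7 →ₗ[ℝ] M7} (i j : Fin 7) (h : ∀ k, L (e k) i j = 0)
    (x : V7) : L x i j = 0 := by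
  have := linear_expand (Matrix.entryLinearMap ℝ ℝ i j ∘ₗ L) x
  simpa [h] using this

theorem entry_eq_zero_of_upper {L : V7 →ₗ[ℝ] M7} {bk : V7 → V7 → V7} (hL : ∀ x, L x ∈ hI)
    (h : ∀ i, proA (L (e i)) 1 0 = 0) {X : M7} (hX : X ∈ infHol L bk) : X 2 1 = 0 := by
  refine blockTriangular_of_mem_infHol ![0, 0, 1, 1, 1, 1, 1] (fun x i j hij => ?_) hX
    (by simp : (0 : ℕ) < 1)
  have h₁ := linear_apply_of_basis 2 1 (by simpa [proA] using h) x
  obtain ⟨A, v, u, y, hA⟩ := hL x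
  rw [hA] at h₁ ⊢
  simp [hmat] at h₁
  fin_cases i <;> fin_cases j <;> simp [hmat, h₁] at hij ⊢

theorem entry_eq_zero_of_lower {L : V7 →ₗ[ℝ] M7} {bk : V7 → V7 → V7} (hL : ∀ x, L x ∈ hI)
    (h : ∀ i, proA (L (e i)) 0 1 = 0) {X : M7} (hX : X ∈ infHol L bk) : X 1 2 = 0 := by
  refine blockTriangular_of_mem_infHol ![0, 1, 0, 1, 1, 1, 1] (fun x i j hij => ?_) hX
    (by simp : (0 : ℕ) < 1)
  have h₁ := linear_apply_of_basis 1 2 (by simpa [proA] using h) x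
  obtain ⟨A, v, u, y, hA⟩ := hL x
  rw [hA] at h₁ ⊢
  simp [hmat] at h₁
  fin_cases i <;> fin_cases j <;> simp [hmat, h₁] at hij ⊢

/-- A holonomy algebra with diagonal `A`-parts containing `h(diag(1,0),0,0)` forces the
connection to have diagonal `A`-parts and `u₁ = 0`. -/
theorem exists_eq_hmat_of_mem {L : V7 →ₗ[ℝ] M7} {bk : V7 → V7 → V7} (hL : ∀ x, L x ∈ hI)
    (hdiag : ∀ X ∈ infHol L bk, ∃ f g w y, X = h3 !![f, 0; 0, g] w y)
    (hX : h3 !![1, 0; 0, 0] 0 0 ∈ infHol L bk) (x : V7) :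
    L x = hmat !![L x 1 1, 0; 0, L x 2 2] (L x 1 6) ![0, L x 5 4] ![L x 1 4, L x 2 4] := by
  obtain ⟨f, g, w, y, hY⟩ := hdiag _ (lie_mem_infHol L bk x hX)
  obtain ⟨A, v, u, z, hA⟩ := hL x
  have h01 := congrFun (congrFun hY 1) 2
  have h10 := congrFun (congrFun hY 2) 1
  have hu := congrFun (congrFun hY 1) 3
  rw [hA] at h01 h10 hu
  simp [h3, hmat] at h01 h10 hu
  rw [hA]
  ext i j
  fin_cases i <;> fin_cases j <;> simp [hmat, h01, h10, hu]

/-- If moreover the holonomy contains `h(diag(0,1),0,0)`, then `u = 0`. -/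
theorem entry_five_four_eq_zero {L : V7 →ₗ[ℝ] M7} {bk : V7 → V7 → V7} (hL : ∀ x, L x ∈ hI)
    (hdiag : ∀ X ∈ infHol L bk, ∃ f g w y, X = h3 !![f, 0; 0, g] w y)
    (hX : h3 !![0, 0; 0, 1] 0 0 ∈ infHol L bk) (x : V7) : L x 5 4 = 0 := by
  obtain ⟨f, g, w, y, hY⟩ := hdiag _ (lie_mem_infHol L bk x hX)
  obtain ⟨A, v, u, z, hA⟩ := hL x
  have hu := congrFun (congrFun hY 2) 3
  rw [hA] at hu
  simp [h3, hmat] at hu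
  rw [hA]
  simp [hmat, hu]

theorem diagConnection {L : V7 →ₗ[ℝ] M7} {bk : V7 → V7 → V7}
    (hbk : ∀ x y : V7, (L x).mulVec y - (L y).mulVec x = bk x y)
    (hjac : ∀ x y z : V7, bk (bk x y) z + bk (bk y z) x + bk (bk z x) y = 0)
    (hdiag : ∀ X ∈ infHol L bk, ∃ f g w y, X = h3 !![f, 0; 0, g] w y)
    (hL : ∀ x, L x
      = hmat !![L x 1 1, 0; 0, L x 2 2] (L x 1 6) ![0, L x 5 4] ![L x 1 4, L x 2 4]) :
    DiagConnection bk (Matrix.entryLinearMap ℝ ℝ 1 1 ∘ₗ L) (Matrix.entryLinearMap ℝ ℝ 2 2 ∘ₗ L)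
      (Matrix.entryLinearMap ℝ ℝ 5 4 ∘ₗ L) (Matrix.entryLinearMap ℝ ℝ 1 6 ∘ₗ L)
      (Matrix.entryLinearMap ℝ ℝ 1 4 ∘ₗ L) (Matrix.entryLinearMap ℝ ℝ 2 4 ∘ₗ L)
      (fun x y => curv L bk x y 1 1) (fun x y => curv L bk x y 2 2)
      (fun x y => curv L bk x y 1 6) (fun x y => curv L bk x y 1 4)
      (fun x y => curv L bk x y 2 4) (Real.sqrt 2) := by
  have hskew : ∀ x y, bk x y = -bk y x := fun x y => by simp [← hbk]
  have hR_skew : ∀ x y i j, curv L bk x y i j = -curv L bk y x i j := fun x y i j => by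
    simp only [curv, hskew y x, map_neg, Matrix.sub_apply, Matrix.neg_apply]
    ring
  have hR : ∀ x y, curv L bk x y = h3 !![curv L bk x y 1 1, 0; 0, curv L bk x y 2 2]
      (curv L bk x y 1 6) ![curv L bk x y 1 4, curv L bk x y 2 4] := fun x y => by
    obtain ⟨f, g, w, z, h⟩ := hdiag _ (curv_mem_infHol L bk x y)
    rw [h]
    ext i j
    fin_cases i <;> fin_cases j <;> simp [h3, hmat]
  have hprod : ∀ x y i j, (L x * L y) i j
      = (hmat !![L x 1 1, 0; 0, L x 2 2] (L x 1 6) ![0, L x 5 4] ![L x 1 4, L x 2 4]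
        * hmat !![L y 1 1, 0; 0, L y 2 2] (L y 1 6) ![0, L y 5 4] ![L y 1 4, L y 2 4]) i j :=
    fun x y i j => by rw [← hL, ← hL]
  have hvec : ∀ x y i, bk x y i
      = (hmat !![L x 1 1, 0; 0, L x 2 2] (L x 1 6) ![0, L x 5 4] ![L x 1 4, L x 2 4]).mulVec y i
        - (hmat !![L y 1 1, 0; 0, L y 2 2] (L y 1 6) ![0, L y 5 4]
          ![L y 1 4, L y 2 4]).mulVec x i :=
    fun x y i => by rw [← hL, ← hL, ← hbk, Pi.sub_apply]
  have hB' : ∀ (i : Fin 7) (x y z : V7),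
      (h3 !![curv L bk x y 1 1, 0; 0, curv L bk x y 2 2] (curv L bk x y 1 6)
        ![curv L bk x y 1 4, curv L bk x y 2 4]).mulVec z i
      + (h3 !![curv L bk y z 1 1, 0; 0, curv L bk y z 2 2] (curv L bk y z 1 6)
        ![curv L bk y z 1 4, curv L bk y z 2 4]).mulVec x i
      + (h3 !![curv L bk z x 1 1, 0; 0, curv L bk z x 2 2] (curv L bk z x 1 6)
        ![curv L bk z x 1 4, curv L bk z x 2 4]).mulVec y i = 0 := fun i x y z => by
    rw [← hR, ← hR, ← hR]
    exact congrFun (curv_bianchi hbk hjac x y z) i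
  refine ⟨hjac, fun x y => ?_, fun x y => ?_, fun x y => ?_, fun x y => ?_, fun x y => ?_,
    fun x y => ?_, fun x y => ?_, fun x y => ?_, fun x y => ?_, fun x y => ?_, fun x y => ?_,
    fun x y => hR_skew x y 1 1, fun x y => hR_skew x y 2 2, fun x y => hR_skew x y 1 6,
    fun x y => hR_skew x y 1 4, fun x y => hR_skew x y 2 4,
    fun x y z => ?_, fun x y z => ?_, fun x y z => ?_, fun x y z => ?_, fun x y z => ?_,
    fun x y z => ?_, fun x y z => ?_⟩
  iterate 7
    · rw [hvec]
      simp [hmat, mulVec, dotProduct, Fin.sum_univ_succ]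
      try ring
  iterate 4
    · simp only [curv, Matrix.sub_apply, hprod]
      simp [hmat, Matrix.mul_apply, Fin.sum_univ_succ]
      try ring
  · have h := hB' 0 x y z
    simp [h3, hmat, mulVec, dotProduct, Fin.sum_univ_succ] at h
    linear_combination h
  · have h := hB' 1 x y z
    simp [h3, hmat, mulVec, dotProduct, Fin.sum_univ_succ] at h
    linear_combination h
  · have h := hB' 2 x y z
    simp [h3, hmat, mulVec, dotProduct, Fin.sum_univ_succ] at h
    linear_combination h
  · have h := hB' 3 x y z
    simp [h3, hmat, mulVec, dotProduct, Fin.sum_univ_succ] at h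
    have hr : Real.sqrt 2 ≠ 0 := by positivity
    apply mul_left_cancel₀ hr
    linear_combination h
  · have h := hB' 4 x y z
    simp [h3, hmat, mulVec, dotProduct, Fin.sum_univ_succ] at h
    linear_combination -h
  · have h := hB' 5 x y z
    simp [h3, hmat, mulVec, dotProduct, Fin.sum_univ_succ] at h
    linear_combination -h
  · have h := hB' 6 x y z
    simp [h3, hmat, mulVec, dotProduct, Fin.sum_univ_succ] at h
    linear_combination -h

/-- A diagonal entry of the `A`-part of the holonomy vanishes as soon as it vanishes on the
curvature. -/
theorem entry_eq_zero_of_curv {L : V7 →ₗ[ℝ] M7} {bk : V7 → V7 → V7} {i : Fin 7}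
    (hi : i = 1 ∨ i = 2)
    (hdiag : ∀ X ∈ infHol L bk, ∃ f g w y, X = h3 !![f, 0; 0, g] w y)
    (hL : ∀ x, L x
      = hmat !![L x 1 1, 0; 0, L x 2 2] (L x 1 6) ![0, L x 5 4] ![L x 1 4, L x 2 4])
    (hR : ∀ x y, curv L bk x y i i = 0) {X : M7} (hX : X ∈ infHol L bk) : X i i = 0 := by
  have hK : infHol L bk ≤ infHol L bk ⊓ LinearMap.ker (Matrix.entryLinearMap ℝ ℝ i i) :=
    infHol_le (fun x y => ⟨curv_mem_infHol L bk x y, hR x y⟩) fun z Y hY =>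
      ⟨lie_mem_infHol L bk z hY.1, by
        obtain ⟨f, g, w, y, rfl⟩ := hdiag _ hY.1
        rw [hL z]
        rcases hi with rfl | rfl <;>
          simp [h3, hmat, mul_comm]⟩
  exact (hK hX).2

theorem h3_mem_semidir {a : Set M2} {A : M2} (hA : A ∈ a) (k : ℕ) : h3 A 0 0 ∈ semidir a k := by
  unfold semidir
  split
  · exact ⟨A, hA, 0, 0, by congr 1; ext i; fin_cases i <;> rfl⟩
  · exact ⟨A, hA, 0, 0, rfl⟩

theorem exists_of_mem_semidir {a : Set M2} {k : ℕ} {X : M7} (h : X ∈ semidir a k) :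
    ∃ A ∈ a, ∃ w y, X = h3 A w y := by
  unfold semidir at h
  split at h
  · obtain ⟨A, hA, w, y, h⟩ := h
    exact ⟨A, hA, w, _, h⟩
  · exact h

theorem stmt14 (bk : V7 → V7 → V7) (L : V7 →ₗ[ℝ] M7)
    (hbk : ∀ x y : V7, (L x).mulVec y - (L y).mulVec x = bk x y)
    (halt : ∀ x : V7, bk x x = 0)
    (hjac : ∀ x y z : V7, bk (bk x y) z + bk (bk y z) x + bk (bk z x) y = 0)
    (hL : ∀ x, L x ∈ hI)
    (hlist : ListedTypeIII (infHol L bk : Set M7))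
    (htri : (∀ i : Fin 7, proA (L (e i)) 1 0 = 0) ∨
            (∀ i : Fin 7, proA (L (e i)) 0 1 = 0)) :
    (infHol L bk : Set M7) = m101 ∨ (infHol L bk : Set M7) = m102 := by
  obtain ⟨a, k, hak, hS⟩ := hlist
  have hmem : ∀ {A : M2}, A ∈ a → h3 A 0 0 ∈ infHol L bk := fun {A} hA => by
    rw [← SetLike.mem_coe, hS]
    exact h3_mem_semidir hA k
  have not_tri : ∀ A : M2, A ∈ a → A 0 1 ≠ 0 → A 1 0 ≠ 0 → False := fun A hA h01 h10 => by
    rcases htri with h | h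
    · exact h10 (by simpa [h3, hmat] using entry_eq_zero_of_upper hL h (hmem hA))
    · exact h01 (by simpa [h3, hmat] using entry_eq_zero_of_lower hL h (hmem hA))
  have hex : ∀ X ∈ infHol L bk, ∃ A ∈ a, ∃ w y, X = h3 A w y := fun X hX =>
    exists_of_mem_semidir (k := k) (hS ▸ hX)
  rcases hak with ⟨rfl | rfl | rfl | rfl, rfl⟩ | ⟨rfl | rfl, hk⟩
  · exact (not_tri !![0, 1; 1, 0] (by simp [sl2]) (by simp) (by simp)).elim
  · exact (not_tri !![0, 1; 1, 0] trivial (by simp) (by simp)).elim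
  · exact (not_tri !![0, -1; 1, 0] ⟨0, 1, rfl⟩ (by simp) (by simp)).elim
  · have hdiag : ∀ X ∈ infHol L bk, ∃ f g w y, X = h3 !![f, 0; 0, g] w y := fun X hX => by
      obtain ⟨A, ⟨h01, h10⟩, w, y, rfl⟩ := hex X hX
      refine ⟨A 0 0, A 1 1, w, y, ?_⟩
      congr 1
      rw [eta_fin_two A, h01, h10]
      rfl
    have h1 : h3 !![1, 0; 0, 0] 0 0 ∈ infHol L bk := hmem (by simp [dd])
    have h2 : h3 !![0, 0; 0, 1] 0 0 ∈ infHol L bk := hmem (by simp [dd])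
    have hL' := exists_eq_hmat_of_mem hL hdiag h1
    have hD := diagConnection hbk hjac hdiag hL'
    rcases hD.F_or_G_eq_zero (fun x => entry_five_four_eq_zero hL hdiag h2 x) with h0 | h0
    · have := entry_eq_zero_of_curv (Or.inl rfl) hdiag hL'
        (fun x y => by rw [hD.F_form x y, h0, zero_mul]) h1
      simp [h3, hmat] at this
    · have := entry_eq_zero_of_curv (Or.inr rfl) hdiag hL'
        (fun x y => by rw [hD.G_form x y, h0, zero_mul]) h2
      simp [h3, hmat] at this
  · rcases hk with rfl | rfl
    · left
      rw [hS]
      ext X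
      simp [semidir, m101]
    · right
      rw [hS]
      ext X
      simp [semidir, m102]
  · have hdiag' : ∀ X ∈ infHol L bk, ∃ f w y, X = h3 !![f, 0; 0, 0] w y := fun X hX => by
      obtain ⟨A, ⟨t, rfl⟩, w, y, rfl⟩ := hex X hX
      exact ⟨t, w, y, rfl⟩
    have hdiag : ∀ X ∈ infHol L bk, ∃ f g w y, X = h3 !![f, 0; 0, g] w y := fun X hX => by
      obtain ⟨f, w, y, h⟩ := hdiag' X hX
      exact ⟨f, 0, w, y, h⟩
    have h1 : h3 !![1, 0; 0, 0] 0 0 ∈ infHol L bk := hmem ⟨1, rfl⟩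
    have hL' := exists_eq_hmat_of_mem hL hdiag h1
    have hD := diagConnection hbk hjac hdiag hL'
    have h0 := hD.F_eq_zero fun x y => by
      obtain ⟨f, w, z, h⟩ := hdiag' _ (curv_mem_infHol L bk x y)
      simp [h, h3, hmat]
    have := entry_eq_zero_of_curv (Or.inl rfl) hdiag hL'
      (fun x y => by rw [hD.F_form x y, h0, zero_mul]) h1
    simp [h3, hmat] at this
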